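/- arXiv:math/0012006 — 2 statements merged into one kernel-verified Lean document; each statement's English description precedes it below -/
import Mathlib

section
/- Let {(A_i, ‖·‖_i)} be a sequence of groups with norms satisfying asdim A_i ≤ n uniformly (with respect to the metrics d_i(x,y) = ‖x⁻¹y‖_i), and let ‖·‖ be the norm on the free product ∗A_i generated by the norms ‖·‖_i. Then asdim (∗A_i, ‖·‖) ≤ 2n + 1. -/
/-- `AsdimOnLE dist A n` : the subset `A` of a space with distance function `dist` has
asymptotic dimension at most `n`. -/
def AsdimOnLE {X : Type*} (dist : X → X → ℝ) (A : Set X) (n : ℕ) : Prop :=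
  ∀ d : ℝ, 0 < d → ∃ R : ℝ, ∃ 𝒰 : Fin (n + 1) → Set (Set X),
    (∀ i, ∀ U ∈ 𝒰 i, U ⊆ A) ∧
    (∀ x ∈ A, ∃ i, ∃ U ∈ 𝒰 i, x ∈ U) ∧
    (∀ i, ∀ U ∈ 𝒰 i, ∀ V ∈ 𝒰 i, U ≠ V → ∀ x ∈ U, ∀ y ∈ V, d ≤ dist x y) ∧
    (∀ i, ∀ U ∈ 𝒰 i, ∀ x ∈ U, ∀ y ∈ U, dist x y ≤ R)

/-- A family of spaces `F α` with distance functions `dist α` satisfies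
`asdim (F α) ≤ n` *uniformly*. -/
def AsdimUnifLE {ι : Type*} {F : ι → Type*} (dist : ∀ α, F α → F α → ℝ) (n : ℕ) : Prop :=
  ∀ d : ℝ, 0 < d → ∃ R : ℝ, ∀ α : ι, ∃ 𝒰 : Fin (n + 1) → Set (Set (F α)),
    (∀ x : F α, ∃ i, ∃ U ∈ 𝒰 i, x ∈ U) ∧
    (∀ i, ∀ U ∈ 𝒰 i, ∀ V ∈ 𝒰 i, U ≠ V → ∀ x ∈ U, ∀ y ∈ V, d ≤ dist α x y) ∧
    (∀ i, ∀ U ∈ 𝒰 i, ∀ x ∈ U, ∀ y ∈ U, dist α x y ≤ R)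

/-- `IsGroupNorm ν` : `ν` is a norm on the group `A`, i.e. `ν (a*b) ≤ ν a + ν b`,
`ν a⁻¹ = ν a`, and `ν x = 0` iff `x = 1`. -/
def IsGroupNorm {A : Type*} [Group A] (ν : A → ℕ) : Prop :=
  (∀ a b : A, ν (a * b) ≤ ν a + ν b) ∧ (∀ a : A, ν a⁻¹ = ν a) ∧ (∀ a : A, ν a = 0 ↔ a = 1)

/-- The norm on the free product `∗ A i` generated by norms `ν i` on the factors:
the norm of `x` is the sum of the norms of the letters of the reduced word of `x`. -/
noncomputable def freeProdNorm {ι : Type*} {A : ι → Type*} [∀ i, Group (A i)]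
    (ν : ∀ i, A i → ℕ) (x : Monoid.CoprodI A) : ℕ :=
  letI := Classical.decEq ι
  letI : ∀ i, DecidableEq (A i) := fun _ => Classical.decEq _
  ((Monoid.CoprodI.Word.equiv x).toList.map fun p => ν p.1 p.2).sum

namespace FreeProdAsdim

open Monoid

variable {ι : Type*} {A : ι → Type*} [∀ i, Group (A i)]

/-- weight of a list of letters -/
def wt (ν : ∀ i, A i → ℕ) (l : List (Σ i, A i)) : ℕ := (l.map fun p => ν p.1 p.2).sum

@[simp] theorem wt_nil (ν : ∀ i, A i → ℕ) : wt ν [] = 0 := rfl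

@[simp] theorem wt_cons (ν : ∀ i, A i → ℕ) (p : Σ i, A i) (l : List (Σ i, A i)) :
    wt ν (p :: l) = ν p.1 p.2 + wt ν l := by simp [wt]

@[simp] theorem wt_append (ν : ∀ i, A i → ℕ) (l m : List (Σ i, A i)) :
    wt ν (l ++ m) = wt ν l + wt ν m := by simp [wt]

/-- product of a list of letters -/
def pr (l : List (Σ i, A i)) : CoprodI A := (l.map fun p => CoprodI.of p.2).prod

@[simp] theorem pr_nil : pr ([] : List (Σ i, A i)) = 1 := rfl

@[simp] theorem pr_cons (p : Σ i, A i) (l : List (Σ i, A i)) :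
    pr (p :: l) = CoprodI.of p.2 * pr l := by simp [pr]

@[simp] theorem pr_append (l m : List (Σ i, A i)) : pr (l ++ m) = pr l * pr m := by simp [pr]

/-- reduced lists -/
def Red (l : List (Σ i, A i)) : Prop :=
  (∀ p ∈ l, p.2 ≠ 1) ∧ l.IsChain (fun p q => p.1 ≠ q.1)

theorem Red.tail {p : Σ i, A i} {l : List (Σ i, A i)} (h : Red (p :: l)) : Red l :=
  ⟨fun q hq => h.1 q (List.mem_cons_of_mem _ hq), h.2.tail⟩

/-- the reduced list of an element -/
noncomputable def lst (x : CoprodI A) : List (Σ i, A i) :=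
  letI := Classical.decEq ι
  letI : ∀ i, DecidableEq (A i) := fun _ => Classical.decEq _
  (CoprodI.Word.equiv x).toList

theorem norm_eq (ν : ∀ i, A i → ℕ) (x : CoprodI A) : freeProdNorm ν x = wt ν (lst x) := rfl

theorem red_lst (x : CoprodI A) : Red (lst x) := by
  classical
  exact ⟨fun p hp => CoprodI.Word.ne_one _ p hp, CoprodI.Word.chain_ne _⟩

theorem pr_lst (x : CoprodI A) : pr (lst x) = x := by
  letI := Classical.decEq ι
  letI : ∀ i, DecidableEq (A i) := fun _ => Classical.decEq _
  exact CoprodI.Word.equiv.symm_apply_apply x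

theorem lst_pr {l : List (Σ i, A i)} (h : Red l) : lst (pr l) = l := by
  letI := Classical.decEq ι
  letI : ∀ i, DecidableEq (A i) := fun _ => Classical.decEq _
  have := CoprodI.Word.equiv.apply_symm_apply (⟨l, fun p hp => h.1 p hp, h.2⟩ : CoprodI.Word A)
  exact congrArg CoprodI.Word.toList this

theorem norm_pr (ν : ∀ i, A i → ℕ) {l : List (Σ i, A i)} (h : Red l) :
    freeProdNorm ν (pr l) = wt ν l := by rw [norm_eq, lst_pr h]

theorem exists_red (ν : ∀ i, A i → ℕ) (hν : ∀ i, IsGroupNorm (ν i)) (l : List (Σ i, A i)) :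
    ∃ l', Red l' ∧ pr l' = pr l ∧ wt ν l' ≤ wt ν l := by
  induction l with
  | nil => exact ⟨[], ⟨by simp, by simp⟩, rfl, le_rfl⟩
  | cons p l ih =>
    obtain ⟨l', hr, hp, hw⟩ := ih
    obtain ⟨i, a⟩ := p
    by_cases ha : a = 1
    · exact ⟨l', hr, by simp [hp, ha], by simp; omega⟩
    have hgen : (∀ q ∈ l'.head?, i ≠ q.1) →
        ∃ l'', Red l'' ∧ pr l'' = pr (⟨i, a⟩ :: l) ∧ wt ν l'' ≤ wt ν (⟨i, a⟩ :: l) := by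
      intro h
      refine ⟨⟨i, a⟩ :: l', ⟨?_, hr.2.cons h⟩, by simp [hp], by simp; omega⟩
      intro q hq
      rcases List.mem_cons.1 hq with rfl | hq
      · exact ha
      · exact hr.1 q hq
    cases l' with
    | nil => exact hgen (by simp)
    | cons q t =>
      obtain ⟨j, b⟩ := q
      by_cases hij : i = j
      · subst hij
        by_cases hab : a * b = 1
        · refine ⟨t, hr.tail, ?_, ?_⟩
          · rw [pr_cons, ← hp, pr_cons, ← mul_assoc, ← map_mul]
            simp [hab]
          · simp at hw ⊢; omega
        · refine ⟨⟨i, a * b⟩ :: t, ⟨?_, ?_⟩, ?_, ?_⟩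
          · intro q hq
            rcases List.mem_cons.1 hq with rfl | hq
            · exact hab
            · exact hr.tail.1 q hq
          · have := hr.2
            rw [List.isChain_cons] at this ⊢
            exact this
          · simp [← hp, mul_assoc]
          · have := (hν i).1 a b
            simp at hw ⊢; omega
      · exact hgen (by simpa using hij)

theorem norm_pr_le (ν : ∀ i, A i → ℕ) (hν : ∀ i, IsGroupNorm (ν i)) (l : List (Σ i, A i)) :
    freeProdNorm ν (pr l) ≤ wt ν l := by
  obtain ⟨l', hr, hp, hw⟩ := exists_red ν hν l
  rw [← hp, norm_pr ν hr]; exact hw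

/-- formal inverse list -/
def il (l : List (Σ i, A i)) : List (Σ i, A i) := (l.map fun p => ⟨p.1, p.2⁻¹⟩).reverse

@[simp] theorem il_nil : il ([] : List (Σ i, A i)) = [] := rfl

@[simp] theorem il_cons (p : Σ i, A i) (l : List (Σ i, A i)) :
    il (p :: l) = il l ++ [⟨p.1, p.2⁻¹⟩] := by simp [il]

theorem pr_il (l : List (Σ i, A i)) : pr (il l) = (pr l)⁻¹ := by
  induction l with
  | nil => simp
  | cons p l ih => simp [ih]

theorem wt_il (ν : ∀ i, A i → ℕ) (hν : ∀ i, IsGroupNorm (ν i)) (l : List (Σ i, A i)) :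
    wt ν (il l) = wt ν l := by
  induction l with
  | nil => simp
  | cons p l ih => simp [ih, (hν p.1).2.1 p.2, add_comm]

theorem red_il {l : List (Σ i, A i)} (h : Red l) : Red (il l) := by
  refine ⟨?_, ?_⟩
  · intro p hp
    simp only [il, List.mem_reverse, List.mem_map] at hp
    obtain ⟨q, hq, rfl⟩ := hp
    simpa using h.1 q hq
  · rw [il, List.isChain_reverse, List.isChain_map]
    exact h.2.imp fun a b hab => hab.symm

theorem getLast_il (l : List (Σ i, A i)) :
    ∀ x ∈ (il l).getLast?, ∃ p ∈ l.head?, p.1 = x.1 := by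
  intro x hx
  cases l with
  | nil => simp at hx
  | cons p l => simp at hx; subst hx; simp

theorem red_append {l m : List (Σ i, A i)} (hl : Red l) (hm : Red m)
    (h : ∀ x ∈ l.getLast?, ∀ y ∈ m.head?, x.1 ≠ y.1) : Red (l ++ m) := by
  refine ⟨?_, List.isChain_append.2 ⟨hl.2, hm.2, h⟩⟩
  intro p hp
  rcases List.mem_append.1 hp with hp | hp
  · exact hl.1 p hp
  · exact hm.1 p hp

/-- distance formula -/
theorem dist_formula (ν : ∀ i, A i → ℕ) (hν : ∀ i, IsGroupNorm (ν i)) (l₁ l₂ : List (Σ i, A i))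
    (h₁ : Red l₁) (h₂ : Red l₂) :
    ∃ w, (∃ s t, l₁ = w ++ s ∧ l₂ = w ++ t ∧
        freeProdNorm ν ((pr l₁)⁻¹ * pr l₂) = wt ν s + wt ν t) ∨
      (∃ i, ∃ a b : A i, ∃ u v, l₁ = w ++ ⟨i, a⟩ :: u ∧ l₂ = w ++ ⟨i, b⟩ :: v ∧
        freeProdNorm ν ((pr l₁)⁻¹ * pr l₂) = ν i (a⁻¹ * b) + wt ν u + wt ν v) := by
  induction l₁ generalizing l₂ with
  | nil => exact ⟨[], Or.inl ⟨[], l₂, rfl, rfl, by simp [norm_pr ν h₂]⟩⟩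
  | cons p u ih =>
    have hgen : (∀ q ∈ l₂.head?, p.1 ≠ q.1) →
        freeProdNorm ν ((pr (p :: u))⁻¹ * pr l₂) = wt ν (p :: u) + wt ν l₂ := by
      intro h
      rw [← pr_il, ← pr_append, norm_pr ν, wt_append, wt_il ν hν]
      refine red_append (red_il h₁) h₂ ?_
      intro x hx y hy
      obtain ⟨q, hq, hqx⟩ := getLast_il _ x hx
      simp at hq
      subst hq
      rw [← hqx]
      exact h y hy
    cases l₂ with
    | nil => exact ⟨[], Or.inl ⟨p :: u, [], rfl, rfl, hgen (by simp)⟩⟩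
    | cons q v =>
      obtain ⟨i, a⟩ := p
      obtain ⟨j, b⟩ := q
      by_cases hij : i = j
      · subst hij
        by_cases hab : a = b
        · subst hab
          have e : (pr (⟨i, a⟩ :: u))⁻¹ * pr (⟨i, a⟩ :: v) = (pr u)⁻¹ * pr v := by
            simp [mul_assoc]
          rw [e]
          obtain ⟨w, h⟩ := ih v h₁.tail h₂.tail
          refine ⟨⟨i, a⟩ :: w, ?_⟩
          rcases h with ⟨s, t, hs, ht, h⟩ | ⟨k, a', b', s, t, hs, ht, h⟩
          · exact Or.inl ⟨s, t, by simp [hs], by simp [ht], h⟩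
          · exact Or.inr ⟨k, a', b', s, t, by simp [hs], by simp [ht], h⟩
        · refine ⟨[], Or.inr ⟨i, a, b, u, v, rfl, rfl, ?_⟩⟩
          have e : (pr (⟨i, a⟩ :: u))⁻¹ * pr (⟨i, b⟩ :: v)
              = pr (il u ++ ⟨i, a⁻¹ * b⟩ :: v) := by
            simp [pr_il, mul_assoc]
          rw [e, norm_pr ν]
          · simp [wt_il ν hν]; omega
          · refine red_append (red_il h₁.tail) ⟨?_, ?_⟩ ?_
            · intro q hq
              rcases List.mem_cons.1 hq with rfl | hq
              · simpa [inv_mul_eq_one] using hab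
              · exact h₂.tail.1 q hq
            · have := h₂.2
              rw [List.isChain_cons] at this ⊢
              exact this
            · intro x hx y hy
              obtain ⟨q, hq, hqx⟩ := getLast_il _ x hx
              simp at hy
              subst hy
              have := h₁.2
              rw [List.isChain_cons] at this
              rw [← hqx]
              exact (this.1 q hq).symm
      · exact ⟨[], Or.inl ⟨⟨i, a⟩ :: u, ⟨j, b⟩ :: v, rfl, rfl, hgen (by simpa using hij)⟩⟩

theorem exists_entry (ν : ∀ i, A i → ℕ) (l : List (Σ i, A i)) (T : ℕ) (hT : 0 < T)
    (h : T ≤ wt ν l) :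
    ∃ p i, ∃ a : A i, ∃ u, l = p ++ ⟨i, a⟩ :: u ∧ wt ν p < T ∧ T ≤ wt ν p + ν i a := by
  induction l generalizing T with
  | nil => simp at h; omega
  | cons q l ih =>
    obtain ⟨j, b⟩ := q
    simp at h
    by_cases hb : T ≤ ν j b
    · exact ⟨[], j, b, l, rfl, by simpa using hT, by simpa using hb⟩
    · obtain ⟨p, i, a, u, rfl, h1, h2⟩ := ih (T - ν j b) (by omega) (by omega)
      exact ⟨⟨j, b⟩ :: p, i, a, u, by simp, by simp; omega, by simp; omega⟩

theorem entry_unique (ν : ∀ i, A i → ℕ) (T : ℕ) (p p' u u' : List (Σ i, A i)) (q q' : Σ i, A i)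
    (h : p ++ q :: u = p' ++ q' :: u')
    (h1 : wt ν p < T) (h2 : T ≤ wt ν p + ν q.1 q.2)
    (h1' : wt ν p' < T) (h2' : T ≤ wt ν p' + ν q'.1 q'.2) : p = p' ∧ q = q' := by
  induction p generalizing p' T with
  | nil =>
    cases p' with
    | nil => simp at h; simp [h.1]
    | cons r p' =>
      simp at h h2 h1'
      rw [h.1] at h2; omega
  | cons s p ih =>
    cases p' with
    | nil => simp at h h1 h2'; rw [h.1] at h1; omega
    | cons r p' =>
      simp at h h1 h2 h1' h2'
      obtain ⟨rfl, h⟩ := h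
      have := ih (T - ν s.1 s.2) p' h (by omega) (by omega) (by omega) (by omega)
      simp [this.1, this.2]

theorem entry_close (ν : ∀ i, A i → ℕ) (hν : ∀ i, IsGroupNorm (ν i)) (T r : ℕ)
    (p p' u u' : List (Σ i, A i)) (i j : ι) (a : A i) (b : A j) (l₁ l₂ : List (Σ i, A i))
    (r1 : Red l₁) (r2 : Red l₂) (e1 : l₁ = p ++ ⟨i, a⟩ :: u) (e2 : l₂ = p' ++ ⟨j, b⟩ :: u')
    (h1 : wt ν p < T) (h2 : T ≤ wt ν p + ν i a)
    (h1' : wt ν p' < T) (h2' : T ≤ wt ν p' + ν j b)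
    (hl1 : T + r ≤ wt ν l₁) (hl2 : T + r ≤ wt ν l₂)
    (hd : freeProdNorm ν ((pr l₁)⁻¹ * pr l₂) < r) :
    p = p' ∧ ∃ h : i = j, ν j ((h ▸ a)⁻¹ * b) < r := by
  have key : ∀ w s t, l₁ = w ++ s → l₂ = w ++ t → T ≤ wt ν w → 0 < T →
      p = p' ∧ ∃ h : i = j, ν j ((h ▸ a)⁻¹ * b) < r := by
    intro w s t hs ht hw hT
    obtain ⟨p0, i0, a0, u0, hw0, h10, h20⟩ := exists_entry ν w T hT hw
    obtain ⟨x1, x2⟩ := entry_unique ν T p p0 u (u0 ++ s) ⟨i, a⟩ ⟨i0, a0⟩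
      (by rw [← e1, hs, hw0]; simp) h1 h2 h10 h20
    obtain ⟨y1, y2⟩ := entry_unique ν T p' p0 u' (u0 ++ t) ⟨j, b⟩ ⟨i0, a0⟩
      (by rw [← e2, ht, hw0]; simp) h1' h2' h10 h20
    rw [← y2] at x2
    cases x2
    refine ⟨x1.trans y1.symm, rfl, ?_⟩
    have : ν i ((a)⁻¹ * a) = 0 := by rw [(hν i).2.2]; simp
    simp only [this]
    omega
  obtain ⟨w, ⟨s, t, hs, ht, h⟩ | ⟨k, a', b', s, t, hs, ht, h⟩⟩ := dist_formula ν hν l₁ l₂ r1 r2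
  · have : wt ν l₁ = wt ν w + wt ν s := by rw [hs, wt_append]
    exact key w s t hs ht (by omega) (by omega)
  · by_cases hw : T ≤ wt ν w
    · exact key w _ _ hs ht hw (by omega)
    have z1 : wt ν l₁ = wt ν w + (ν k a' + wt ν s) := by rw [hs, wt_append, wt_cons]
    have z2 : wt ν l₂ = wt ν w + (ν k b' + wt ν t) := by rw [ht, wt_append, wt_cons]
    obtain ⟨x1, x2⟩ := entry_unique ν T p w u s ⟨i, a⟩ ⟨k, a'⟩
      (by rw [← e1, hs]) h1 h2 (by omega) (by simp only; omega)
    obtain ⟨y1, y2⟩ := entry_unique ν T p' w u' t ⟨j, b⟩ ⟨k, b'⟩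
      (by rw [← e2, ht]) h1' h2' (by omega) (by simp only; omega)
    cases x2
    cases y2
    exact ⟨x1.trans y1.symm, rfl, by simp only; omega⟩

theorem norm_mul_le (ν : ∀ i, A i → ℕ) (hν : ∀ i, IsGroupNorm (ν i)) (x y : CoprodI A) :
    freeProdNorm ν (x * y) ≤ freeProdNorm ν x + freeProdNorm ν y := by
  have := norm_pr_le ν hν (lst x ++ lst y)
  rwa [pr_append, pr_lst, pr_lst, wt_append] at this

theorem norm_inv_le (ν : ∀ i, A i → ℕ) (hν : ∀ i, IsGroupNorm (ν i)) (x : CoprodI A) :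
    freeProdNorm ν x⁻¹ ≤ freeProdNorm ν x := by
  have := norm_pr_le ν hν (il (lst x))
  rwa [pr_il, pr_lst, wt_il ν hν] at this

theorem entry_diam (ν : ∀ i, A i → ℕ) (hν : ∀ i, IsGroupNorm (ν i))
    (p u v : List (Σ i, A i)) (i : ι) (a b : A i) (x y : CoprodI A)
    (hx : lst x = p ++ ⟨i, a⟩ :: u) (hy : lst y = p ++ ⟨i, b⟩ :: v) :
    freeProdNorm ν (x⁻¹ * y) ≤ ν i (a⁻¹ * b) + wt ν u + wt ν v := by
  have := norm_pr_le ν hν (il u ++ ⟨i, a⁻¹ * b⟩ :: v)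
  have e : x⁻¹ * y = pr (il u ++ ⟨i, a⁻¹ * b⟩ :: v) := by
    rw [← pr_lst x, ← pr_lst y, hx, hy]
    simp [pr_il, mul_assoc]
  rw [e]
  simp only [wt_append, wt_cons, wt_il ν hν] at this
  omega

/-- basic pieces of the cover: everything in the annulus `k` -/
def ann (ν : ∀ i, A i → ℕ) (r k : ℕ) : Set (CoprodI A) :=
  {x | k * r ≤ freeProdNorm ν x ∧ freeProdNorm ν x < (k + 1) * r}

/-- pieces of the cover: elements of the annulus `k` whose reduced word enters the level
`T = (k-1) r` from `p` through a letter of `U`. -/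
def piece (ν : ∀ i, A i → ℕ) (r k : ℕ) (p : List (Σ i, A i)) (i : ι) (U : Set (A i)) :
    Set (CoprodI A) :=
  {x | x ∈ ann ν r k ∧ ∃ a ∈ U, ∃ u, lst x = p ++ ⟨i, a⟩ :: u ∧
    wt ν p < (k - 1) * r ∧ (k - 1) * r ≤ wt ν p + ν i a}

/-- the families -/
def fam (ν : ∀ i, A i → ℕ) (r : ℕ) {n : ℕ} (𝒰 : ∀ i, Fin (n + 1) → Set (Set (A i)))
    (c : Fin 2 × Fin (n + 1)) : Set (Set (CoprodI A)) :=
  {S | ∃ k : ℕ, k % 2 = c.1 ∧ ((k ≤ 1 ∧ S = ann ν r k) ∨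
    (2 ≤ k ∧ ∃ p i, ∃ U ∈ 𝒰 i c.2, S = piece ν r k p i U))}

theorem fam_ann {ν : ∀ i, A i → ℕ} {r n : ℕ} {𝒰 : ∀ i, Fin (n + 1) → Set (Set (A i))}
    {c : Fin 2 × Fin (n + 1)} {S : Set (CoprodI A)} {k : ℕ}
    (h : ((k ≤ 1 ∧ S = ann ν r k) ∨
    (2 ≤ k ∧ ∃ p i, ∃ U ∈ 𝒰 i c.2, S = piece ν r k p i U))) : S ⊆ ann ν r k := by
  rcases h with ⟨_, rfl⟩ | ⟨_, p, i, U, _, rfl⟩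
  · exact subset_rfl
  · exact fun x hx => hx.1

theorem ann_lt (ν : ∀ i, A i → ℕ) (hν : ∀ i, IsGroupNorm (ν i)) {r k k' : ℕ}
    {x y : CoprodI A} (hx : x ∈ ann ν r k) (hy : y ∈ ann ν r k')
    (hd : freeProdNorm ν (x⁻¹ * y) < r) : k' < k + 2 := by
  by_contra hk
  have h1 := norm_mul_le ν hν x (x⁻¹ * y)
  rw [mul_inv_cancel_left] at h1
  have h2 := hx.2
  have h3 := hy.1
  have h4 : (k + 2) * r ≤ k' * r := Nat.mul_le_mul_right _ (by omega)
  have h5 : (k + 2) * r = (k + 1) * r + r := by ring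
  omega

theorem fam_disj (ν : ∀ i, A i → ℕ) (hν : ∀ i, IsGroupNorm (ν i)) {r n : ℕ}
    (𝒰 : ∀ i, Fin (n + 1) → Set (Set (A i)))
    (h𝒰 : ∀ i c, ∀ U ∈ 𝒰 i c, ∀ V ∈ 𝒰 i c, U ≠ V → ∀ x ∈ U, ∀ y ∈ V, r ≤ ν i (x⁻¹ * y))
    (c : Fin 2 × Fin (n + 1)) (S : Set (CoprodI A)) (hS : S ∈ fam ν r 𝒰 c)
    (S' : Set (CoprodI A)) (hS' : S' ∈ fam ν r 𝒰 c) (x y : CoprodI A) (hx : x ∈ S) (hy : y ∈ S')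
    (hd : freeProdNorm ν (x⁻¹ * y) < r) : S = S' := by
  obtain ⟨k, hk, h⟩ := hS
  obtain ⟨k', hk', h'⟩ := hS'
  have ax := fam_ann h hx
  have ay := fam_ann h' hy
  have hd' : freeProdNorm ν (y⁻¹ * x) < r := by
    have := norm_inv_le ν hν (x⁻¹ * y)
    rw [mul_inv_rev, inv_inv] at this
    omega
  have l1 := ann_lt ν hν ax ay hd
  have l2 := ann_lt ν hν ay ax hd'
  have hkk : k = k' := by omega
  subst hkk
  rcases h with ⟨hk1, rfl⟩ | ⟨hk2, p, i, U, hU, rfl⟩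
  · rcases h' with ⟨_, rfl⟩ | ⟨h2, _⟩
    · rfl
    · omega
  rcases h' with ⟨h2, _⟩ | ⟨_, p', j, V, hV, rfl⟩
  · omega
  obtain ⟨-, a, ha, u, hu, hu1, hu2⟩ := hx
  obtain ⟨-, b, hb, v, hv, hv1, hv2⟩ := hy
  have hT : (k - 1) * r + r = k * r := by
    obtain ⟨m, rfl⟩ : ∃ m, k = m + 1 := ⟨k - 1, by omega⟩
    simp; ring
  obtain ⟨rfl, rfl, hab⟩ := entry_close ν hν ((k - 1) * r) r p p' u v i j a b (lst x) (lst y)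
    (red_lst x) (red_lst y) hu hv hu1 hu2 hv1 hv2 (hT ▸ ax.1) (hT ▸ ay.1)
    (by rwa [pr_lst, pr_lst])
  by_cases hUV : U = V
  · rw [hUV]
  · have := h𝒰 i c.2 U hU V hV hUV a ha b hb
    simp only at hab
    omega

theorem fam_diam (ν : ∀ i, A i → ℕ) (hν : ∀ i, IsGroupNorm (ν i)) {r n R : ℕ}
    (𝒰 : ∀ i, Fin (n + 1) → Set (Set (A i)))
    (h𝒰 : ∀ i c, ∀ U ∈ 𝒰 i c, ∀ x ∈ U, ∀ y ∈ U, ν i (x⁻¹ * y) ≤ R)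
    (c : Fin 2 × Fin (n + 1)) (S : Set (CoprodI A)) (hS : S ∈ fam ν r 𝒰 c)
    (x y : CoprodI A) (hx : x ∈ S) (hy : y ∈ S) :
    freeProdNorm ν (x⁻¹ * y) ≤ R + 4 * r := by
  obtain ⟨k, hk, h⟩ := hS
  have ax := (fam_ann h hx).2
  have ay := (fam_ann h hy).2
  rcases h with ⟨hk1, rfl⟩ | ⟨hk2, p, i, U, hU, rfl⟩
  · have h1 := norm_mul_le ν hν x⁻¹ y
    have h2 := norm_inv_le ν hν x
    have h3 : (k + 1) * r ≤ 2 * r := Nat.mul_le_mul_right _ (by omega)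
    omega
  · obtain ⟨-, a, ha, u, hu, hu1, hu2⟩ := hx
    obtain ⟨-, b, hb, v, hv, hv1, hv2⟩ := hy
    have h1 := entry_diam ν hν p u v i a b x y hu hv
    have h2 := h𝒰 i c.2 U hU a ha b hb
    rw [norm_eq, hu, wt_append, wt_cons] at ax
    rw [norm_eq, hv, wt_append, wt_cons] at ay
    have hT : (k - 1) * r + 2 * r = (k + 1) * r := by
      obtain ⟨m, rfl⟩ : ∃ m, k = m + 1 := ⟨k - 1, by omega⟩
      simp; ring
    simp only at ax ay
    omega

theorem fam_cover (ν : ∀ i, A i → ℕ) {r n : ℕ} (hr : 0 < r)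
    (𝒰 : ∀ i, Fin (n + 1) → Set (Set (A i)))
    (h𝒰 : ∀ i, ∀ x : A i, ∃ c, ∃ U ∈ 𝒰 i c, x ∈ U) (x : CoprodI A) :
    ∃ c, ∃ S ∈ fam ν r 𝒰 c, x ∈ S := by
  obtain ⟨k, hk⟩ : ∃ k, k = freeProdNorm ν x / r := ⟨_, rfl⟩
  have hx : x ∈ ann ν r k := by
    subst hk
    exact ⟨Nat.div_mul_le_self _ _, by
      have := Nat.lt_mul_div_succ (freeProdNorm ν x) hr
      rwa [mul_comm] at this⟩
  have hk2 : k % 2 < 2 := Nat.mod_lt _ (by norm_num)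
  by_cases h1 : k ≤ 1
  · exact ⟨(⟨k % 2, hk2⟩, 0), ann ν r k, ⟨k, rfl, Or.inl ⟨h1, rfl⟩⟩, hx⟩
  · have hT : 0 < (k - 1) * r := Nat.mul_pos (by omega) hr
    have hT' : (k - 1) * r ≤ wt ν (lst x) :=
      le_trans (Nat.mul_le_mul_right _ (by omega)) hx.1
    obtain ⟨p, i, a, u, hu, hu1, hu2⟩ := exists_entry ν (lst x) _ hT hT'
    obtain ⟨c, U, hU, ha⟩ := h𝒰 i a
    exact ⟨(⟨k % 2, hk2⟩, c), piece ν r k p i U, ⟨k, rfl, Or.inr ⟨by omega, p, i, U, hU, rfl⟩⟩,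
      hx, a, ha, u, hu, hu1, hu2⟩

end FreeProdAsdim

/-- **Theorem 4.** Let `(A i, ν i)` be a sequence of groups with norms satisfying
`asdim A i ≤ n` uniformly, and let `‖·‖` be the norm on the free product `∗ A i`
generated by the norms `ν i`.  Then `asdim (∗ A i, ‖·‖) ≤ 2n + 1`. -/
theorem asdim_coprodI_le {ι : Type*} {A : ι → Type*} [∀ i, Group (A i)]
    (ν : ∀ i, A i → ℕ) (hν : ∀ i, IsGroupNorm (ν i)) (n : ℕ)
    (hunif : AsdimUnifLE (fun i (x y : A i) => ((ν i (x⁻¹ * y) : ℕ) : ℝ)) n) :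
    AsdimOnLE (fun x y : Monoid.CoprodI A => ((freeProdNorm ν (x⁻¹ * y) : ℕ) : ℝ))
      (Set.univ : Set (Monoid.CoprodI A)) (2 * n + 1) := by
  intro d hd
  have hr : 0 < ⌈d⌉₊ := Nat.ceil_pos.2 hd
  have hdr : d ≤ (⌈d⌉₊ : ℝ) := Nat.le_ceil d
  generalize ⌈d⌉₊ = r at hr hdr
  obtain ⟨R, hR⟩ := hunif r (by exact_mod_cast hr)
  choose 𝒰 hcov hdis hdiam using hR
  let e : Fin 2 × Fin (n + 1) ≃ Fin (2 * n + 1 + 1) := finProdFinEquiv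
  refine ⟨((⌈R⌉₊ + 4 * r : ℕ) : ℝ), fun c => FreeProdAsdim.fam ν r 𝒰 (e.symm c),
    fun _ _ _ => Set.subset_univ _, ?_, ?_, ?_⟩
  · intro x _
    obtain ⟨c, S, hS, hx⟩ := FreeProdAsdim.fam_cover ν hr 𝒰 hcov x
    exact ⟨e c, S, by simpa using hS, hx⟩
  · intro c S hS S' hS' hne x hx y hy
    by_contra hlt
    refine hne (FreeProdAsdim.fam_disj ν hν 𝒰 ?_ _ S hS S' hS' x y hx hy ?_)
    · intro i c U hU V hV hUV a ha b hb
      exact Nat.cast_le.1 (hdis i c U hU V hV hUV a ha b hb)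
    · have := lt_of_lt_of_le (not_le.1 hlt) hdr
      exact Nat.cast_lt.1 this
  · intro c S hS x hx y hy
    have := FreeProdAsdim.fam_diam ν hν (R := ⌈R⌉₊) 𝒰 (fun i c U hU a ha b hb => by
      have h := (hdiam i c U hU a ha b hb).trans (Nat.le_ceil R)
      exact Nat.cast_le.1 h) _ S hS x y hx hy
    exact Nat.cast_le.2 this
end

section
/- Let G' be the HNN extension of a finitely generated group G by a monomorphism φ : A → G of a subgroup A ≤ G, with the word metric from S' = S ∪ {y, y⁻¹}. For l ≥ 0 let P_l = {x ∈ G' : l(x) = l}, where l(x) is the length (number of occurrences of y^{±1}) of a reduced presentation of x, equipped with the induced metric. If asdim G ≤ n with n > 0, then asdim P_l ≤ n for all l. -/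
/-- The word norm of `x` with respect to the alphabet `S ∪ S⁻¹`. -/
noncomputable def wordNorm {G : Type*} [Group G] (S : Set G) (x : G) : ℕ :=
  sInf {n : ℕ | ∃ l : List G, l.length = n ∧ (∀ g ∈ l, g ∈ S ∨ g⁻¹ ∈ S) ∧ l.prod = x}

/-- The left-invariant word metric `d_S(x,y) = ‖x⁻¹y‖_S`. -/
noncomputable def wordDist {G : Type*} [Group G] (S : Set G) (x y : G) : ℝ :=
  (wordNorm S (x⁻¹ * y) : ℝ)

/-- `IsReducedPres A B nn g ε` : the word `g₀ y^{ε₁} g₁ ⋯ y^{εₙ} gₙ` (with `nn = n`)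
is reduced. -/
def IsReducedPres {G : Type*} [Group G] (A B : Subgroup G) (nn : ℕ)
    (g : Fin (nn + 1) → G) (ε : Fin nn → ℤ) : Prop :=
  (∀ i, ε i = 1 ∨ ε i = -1) ∧
  ∀ (j : ℕ) (h : j + 1 < nn),
    (ε ⟨j, Nat.lt_of_succ_lt h⟩ = 1 ∧ ε ⟨j + 1, h⟩ = -1 →
      g ⟨j + 1, by omega⟩ ∉ A) ∧
    (ε ⟨j, Nat.lt_of_succ_lt h⟩ = -1 ∧ ε ⟨j + 1, h⟩ = 1 →
      g ⟨j + 1, by omega⟩ ∉ B)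

/-- The set `P_l ⊆ G'` of elements of the HNN extension admitting a reduced
presentation of length `l`. -/
def HNNLengthSet {G : Type*} [Group G] (A B : Subgroup G) (φ : A ≃* B) (l : ℕ) :
    Set (HNNExtension G A B φ) :=
  {x | ∃ (g : Fin (l + 1) → G) (ε : Fin l → ℤ), IsReducedPres A B l g ε ∧
    x = HNNExtension.of (g 0) *
      (List.ofFn fun i : Fin l =>
        HNNExtension.t ^ (ε i) * HNNExtension.of (g i.succ)).prod}

universe u

/-- Colouring form of the scale-`d` asymptotic dimension condition. -/
def ColAt {X : Type u} (ρ : X → X → ℕ) (A : Set X) (n d : ℕ) : Prop :=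
  ∃ R : ℕ, ∃ L : Type u, ∃ c : X → Fin (n + 1), ∃ f : X → L,
    ∀ x ∈ A, ∀ y ∈ A, c x = c y →
      (f x = f y → ρ x y ≤ R) ∧ (f x ≠ f y → d ≤ ρ x y)

theorem ColAt.toAsdim {X : Type u} {ρ : X → X → ℕ} {A : Set X} {n : ℕ}
    (h : ∀ d, ColAt ρ A n d) : AsdimOnLE (fun x y => (ρ x y : ℝ)) A n := by
  intro d _
  obtain ⟨R, L, c, f, hf⟩ := h ⌈d⌉₊
  refine ⟨R, fun i => Set.range fun p : L => {x | x ∈ A ∧ c x = i ∧ f x = p}, ?_, ?_, ?_, ?_⟩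
  · rintro i _ ⟨p, rfl⟩ x hx
    exact hx.1
  · intro x hx
    exact ⟨c x, _, ⟨f x, rfl⟩, hx, rfl, rfl⟩
  · rintro i _ ⟨p, rfl⟩ _ ⟨q, rfl⟩ hne x ⟨hx, hcx, hfx⟩ y ⟨hy, hcy, hfy⟩
    have hpq : f x ≠ f y := by
      rw [hfx, hfy]; rintro rfl; exact hne rfl
    have := (hf x hx y hy (hcx.trans hcy.symm)).2 hpq
    exact (Nat.le_ceil d).trans (by dsimp only; exact_mod_cast this)
  · rintro i _ ⟨p, rfl⟩ x ⟨hx, hcx, hfx⟩ y ⟨hy, hcy, hfy⟩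
    have := (hf x hx y hy (hcx.trans hcy.symm)).1 (hfx.trans hfy.symm)
    dsimp only
    exact_mod_cast this

theorem ColAt.ofAsdim {X : Type u} {ρ : X → X → ℕ} {A : Set X} {n : ℕ}
    (h : AsdimOnLE (fun x y => (ρ x y : ℝ)) A n) (d : ℕ) : ColAt ρ A n d := by
  classical
  obtain ⟨R, U, -, hcov, hdis, hbd⟩ := h (d + 1) (by positivity)
  have : ∀ x, ∃ p : Fin (n + 1) × Set X, x ∈ A → p.2 ∈ U p.1 ∧ x ∈ p.2 := by
    intro x
    by_cases hx : x ∈ A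
    · obtain ⟨i, V, hV, hxV⟩ := hcov x hx
      exact ⟨(i, V), fun _ => ⟨hV, hxV⟩⟩
    · exact ⟨(0, ∅), fun h => absurd h hx⟩
  choose p hp using this
  refine ⟨⌈R⌉₊, Set X, fun x => (p x).1, fun x => (p x).2, ?_⟩
  intro x hx y hy hc
  have h1 := hp x hx
  have h2 := hp y hy
  dsimp only at hc
  rw [← hc] at h2
  constructor
  · intro hf
    dsimp only at hf
    rw [← hf] at h2
    have := hbd _ _ h1.1 _ h1.2 _ h2.2
    dsimp only at this
    exact_mod_cast this.trans (Nat.le_ceil R)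
  · intro hf
    have := hdis _ _ h1.1 _ h2.1 hf _ h1.2 _ h2.2
    have : ((d : ℕ) : ℝ) ≤ ρ x y := by linarith
    exact_mod_cast this

theorem ColAt.mono {X : Type u} {ρ : X → X → ℕ} {A B : Set X} {n d : ℕ}
    (h : ColAt ρ B n d) (hAB : A ⊆ B) : ColAt ρ A n d := by
  obtain ⟨R, L, c, f, hf⟩ := h
  exact ⟨R, L, c, f, fun x hx y hy => hf x (hAB hx) y (hAB hy)⟩

theorem ColAt.nbhd {X : Type u} {ρ : X → X → ℕ} (hsymm : ∀ x y, ρ x y = ρ y x)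
    (htri : ∀ x y z, ρ x z ≤ ρ x y + ρ y z) {Y Z : Set X} {n : ℕ} (C : ℕ)
    (hYZ : ∀ y ∈ Y, ∃ z ∈ Z, ρ y z ≤ C) (h : ∀ d, ColAt ρ Z n d) (d : ℕ) :
    ColAt ρ Y n d := by
  classical
  have : ∀ y, ∃ z, y ∈ Y → z ∈ Z ∧ ρ y z ≤ C := by
    intro y
    by_cases hy : y ∈ Y
    · obtain ⟨z, hz⟩ := hYZ y hy
      exact ⟨z, fun _ => hz⟩
    · exact ⟨y, fun h => absurd h hy⟩
  choose z hz using this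
  obtain ⟨R, L, c, f, hf⟩ := h (d + 2 * C)
  refine ⟨R + 2 * C, L, fun y => c (z y), fun y => f (z y), ?_⟩
  intro x hx y hy hc
  obtain ⟨hx1, hx2⟩ := hz x hx
  obtain ⟨hy1, hy2⟩ := hz y hy
  obtain ⟨h1, h2⟩ := hf _ hx1 _ hy1 hc
  have t1 := htri x (z x) y
  have t2 := htri (z x) (z y) y
  have t3 := htri (z x) x (z y)
  have t4 := htri x y (z y)
  have s1 := hsymm x (z x)
  have s2 := hsymm y (z y)
  constructor
  · intro e
    have := h1 e
    omega
  · intro e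
    have := h2 e
    omega

theorem ColAt.union {X : Type u} {ρ : X → X → ℕ} (hself : ∀ x, ρ x x = 0)
    (hsymm : ∀ x y, ρ x y = ρ y x)
    (htri : ∀ x y z, ρ x z ≤ ρ x y + ρ y z) {A Y : Set X} {n d : ℕ}
    (hY : ∀ d, ColAt ρ Y n d) (hA : ColAt ρ (A \ Y) n d) : ColAt ρ A n d := by
  classical
  obtain ⟨R₁, L₁, c₁, f₁, h₁⟩ := hA
  obtain ⟨R₂, L₂, c₂, f₂, h₂⟩ := hY (2 * (R₁ + d) + d)
  let col : X → Fin (n + 1) := fun x => if x ∈ Y then c₂ x else c₁ x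
  let Near : X → X → Prop := fun x y => y ∈ Y ∧ c₂ y = col x ∧
    (x = y ∨ (x ∉ Y ∧ ∃ x' ∈ A \ Y, c₁ x' = c₁ x ∧ f₁ x' = f₁ x ∧ ρ x' y < d))
  have near_dist : ∀ x ∈ A, ∀ y, Near x y → ρ x y ≤ R₁ + d := by
    rintro x hx y ⟨hy, hc, rfl | ⟨hxY, x', hx', hcc, hff, hlt⟩⟩
    · rw [hself]; omega
    · have e1 := (h₁ x ⟨hx, hxY⟩ x' hx' hcc.symm).1 hff.symm
      have := htri x x' y
      omega
  let f : X → L₁ ⊕ L₂ := fun x =>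
    if h : ∃ y, Near x y then Sum.inr (f₂ h.choose) else Sum.inl (f₁ x)
  have key : ∀ x ∈ A, (∃ y, Near x y ∧ f x = Sum.inr (f₂ y)) ∨
      ((¬ ∃ y, Near x y) ∧ f x = Sum.inl (f₁ x)) := by
    intro x hx
    by_cases h : ∃ y, Near x y
    · left
      exact ⟨h.choose, h.choose_spec, by simp only [f, dif_pos h]⟩
    · right
      exact ⟨h, by simp only [f, dif_neg h]⟩
  have notY : ∀ x, (¬ ∃ y, Near x y) → x ∉ Y := by
    intro x h hx
    exact h ⟨x, hx, by simp [col, hx], Or.inl rfl⟩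
  have colY : ∀ x, x ∈ Y → col x = c₂ x := fun x hx => by simp [col, hx]
  have colN : ∀ x, x ∉ Y → col x = c₁ x := fun x hx => by simp [col, hx]
  have mixed : ∀ x ∈ A, ∀ x' ∈ A, col x = col x' → (¬ ∃ y, Near x y) →
      (∃ y, Near x' y) → d ≤ ρ x x' := by
    intro x hx x' hx' hc hn ⟨y, hy⟩
    have hxY := notY x hn
    by_contra hlt
    push Not at hlt
    by_cases hx'Y : x' ∈ Y
    · exact hn ⟨x', hx'Y, by rw [hc, colY _ hx'Y], Or.inr ⟨hxY, x, ⟨hx, hxY⟩, rfl, rfl, hlt⟩⟩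
    · have hcc : c₁ x = c₁ x' := by rw [← colN _ hxY, ← colN _ hx'Y, hc]
      obtain ⟨hyY, hyc, rfl | ⟨-, x'', hx'', h1, h2, h3⟩⟩ := hy
      · exact hx'Y hyY
      · by_cases hff : f₁ x = f₁ x'
        · exact hn ⟨y, hyY, by rw [hyc, hc], Or.inr ⟨hxY, x'', hx'', h1.trans hcc.symm,
            h2.trans hff.symm, h3⟩⟩
        · have := (h₁ x ⟨hx, hxY⟩ x' ⟨hx', hx'Y⟩ hcc).2 hff
          omega
  refine ⟨R₁ + R₂ + 2 * (R₁ + d), L₁ ⊕ L₂, col, f, ?_⟩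
  intro x hx x' hx' hc
  rcases key x hx with ⟨y, hy, hfy⟩ | ⟨hn, hfx⟩ <;>
  rcases key x' hx' with ⟨y', hy', hfy'⟩ | ⟨hn', hfx'⟩
  · have d1 := near_dist _ hx _ hy
    have d2 := near_dist _ hx' _ hy'
    have hcy : c₂ y = c₂ y' := by rw [hy.2.1, hy'.2.1, hc]
    obtain ⟨q1, q2⟩ := h₂ y hy.1 y' hy'.1 hcy
    have t1 := htri x y x'
    have t2 := htri y y' x'
    have t3 := htri y x y'
    have t4 := htri x x' y'
    have s1 := hsymm x y
    have s2 := hsymm x' y'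
    rw [hfy, hfy']
    constructor
    · intro e
      have := q1 (Sum.inr.inj e)
      omega
    · intro e
      have := q2 (fun h => e (by rw [h]))
      omega
  · rw [hfy, hfx']
    refine ⟨fun e => (Sum.inr_ne_inl e).elim, fun _ => ?_⟩
    rw [hsymm]
    exact mixed x' hx' x hx hc.symm hn' ⟨y, hy⟩
  · rw [hfx, hfy']
    exact ⟨fun e => (Sum.inl_ne_inr e).elim, fun _ => mixed x hx x' hx' hc hn ⟨y', hy'⟩⟩
  · have n1 := notY _ hn
    have n2 := notY _ hn'
    obtain ⟨q1, q2⟩ := h₁ x ⟨hx, n1⟩ x' ⟨hx', n2⟩ (by rw [← colN _ n1, ← colN _ n2, hc])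
    rw [hfx, hfx']
    constructor
    · intro e
      have := q1 (Sum.inl.inj e)
      omega
    · intro e
      exact q2 (fun h => e (by rw [h]))

theorem ColAt.step {H : Type u} [Group H] (N : H → ℕ) (hone : N 1 = 0)
    (hinv : ∀ x, N x⁻¹ = N x) (hmul : ∀ x y, N (x * y) ≤ N x + N y)
    (hfin : ∀ r, {x | N x ≤ r}.Finite) (K : Subgroup H) {X Z : Set H} {n : ℕ}
    (hK : ∀ d, ColAt (fun x y => N (x⁻¹ * y)) (K : Set H) n d)
    (hZ : ∀ d, ColAt (fun x y => N (x⁻¹ * y)) Z n d)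
    (hk : ∀ h, h ∉ K → ∃ k, ∀ w ∈ X, w * h ∈ X → w * k ∈ Z) (d : ℕ) :
    ColAt (fun x y => N (x⁻¹ * y)) X n d := by
  classical
  have hself : ∀ x : H, N (x⁻¹ * x) = 0 := by simp [hone]
  have hsymm : ∀ x y : H, N (x⁻¹ * y) = N (y⁻¹ * x) := by
    intro x y
    rw [← hinv]; simp
  have htri : ∀ x y z : H, N (x⁻¹ * z) ≤ N (x⁻¹ * y) + N (y⁻¹ * z) := by
    intro x y z
    have := hmul (x⁻¹ * y) (y⁻¹ * z)
    simpa [mul_assoc] using this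
  have hk' : ∀ h, ∃ k, h ∉ K → ∀ w ∈ X, w * h ∈ X → w * k ∈ Z := by
    intro h
    by_cases hh : h ∈ K
    · exact ⟨1, fun h' => absurd hh h'⟩
    · obtain ⟨k, h'⟩ := hk h hh
      exact ⟨k, fun _ => h'⟩
  choose k hk' using hk'
  obtain ⟨C, hC⟩ := ((hfin d).image fun h => N (k h)).bddAbove
  have hC' : ∀ h, N h ≤ d → N (k h) ≤ C := fun h hh => hC ⟨h, hh, rfl⟩
  let Y : Set H := {w | ∃ z ∈ Z, N (w⁻¹ * z) ≤ C}
  refine ColAt.union (Y := Y) hself hsymm htri ?_ ?_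
  · exact ColAt.nbhd hsymm htri C (fun y hy => hy) hZ
  · obtain ⟨R, L, c, f, hf⟩ := hK d
    let g : H → H := fun x => (Quotient.out (x : H ⧸ K))⁻¹ * x
    have hg : ∀ x, g x ∈ K := by
      intro x
      have : ((Quotient.out (x : H ⧸ K) : H) : H ⧸ K) = (x : H ⧸ K) := Quotient.out_eq' _
      exact QuotientGroup.eq.1 this
    have hgg : ∀ x y : H, (x : H ⧸ K) = (y : H ⧸ K) → (g x)⁻¹ * g y = x⁻¹ * y := by
      intro x y h
      simp only [g, h]
      group
    refine ⟨R, (H ⧸ K) × L, fun x => c (g x), fun x => ((x : H ⧸ K), f (g x)), ?_⟩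
    intro x hx y hy hc
    have main := hf (g x) (hg x) (g y) (hg y) hc
    dsimp only at main ⊢
    by_cases hxy : (x : H ⧸ K) = (y : H ⧸ K)
    · rw [hgg x y hxy] at main
      refine ⟨fun e => main.1 (Prod.mk.inj e).2, fun e => main.2 fun h => e ?_⟩
      rw [hxy, h]
    · refine ⟨fun e => absurd (Prod.mk.inj e).1 hxy, fun _ => ?_⟩
      by_contra hlt
      push Not at hlt
      have hnot : x⁻¹ * y ∉ K := fun h => hxy (QuotientGroup.eq.2 h)
      have := hk' _ hnot x hx.1 (by simpa using hy.1)
      exact hx.2 ⟨_, this, by simpa using hC' _ hlt.le⟩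

section WordNorm

variable {H : Type*} [Group H]

theorem exists_word {T : Set H} (hT : Subgroup.closure T = ⊤) (x : H) :
    ∃ l : List H, (∀ g ∈ l, g ∈ T ∨ g⁻¹ ∈ T) ∧ l.prod = x := by
  have hx : x ∈ Subgroup.closure T := by rw [hT]; trivial
  rw [← Subgroup.mem_toSubmonoid, Subgroup.closure_toSubmonoid] at hx
  obtain ⟨l, h1, h2⟩ := Submonoid.exists_list_of_mem_closure hx
  exact ⟨l, fun g hg => h1 g hg, h2⟩

theorem wordNorm_le {T : Set H} (l : List H) (h : ∀ g ∈ l, g ∈ T ∨ g⁻¹ ∈ T) :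
    wordNorm T l.prod ≤ l.length :=
  Nat.sInf_le ⟨l, rfl, h, rfl⟩

theorem wordNorm_spec {T : Set H} (hT : Subgroup.closure T = ⊤) (x : H) :
    ∃ l : List H, l.length = wordNorm T x ∧ (∀ g ∈ l, g ∈ T ∨ g⁻¹ ∈ T) ∧ l.prod = x := by
  obtain ⟨l, h1, h2⟩ := exists_word hT x
  exact Nat.sInf_mem (s := {n : ℕ | ∃ l : List H, l.length = n ∧
    (∀ g ∈ l, g ∈ T ∨ g⁻¹ ∈ T) ∧ l.prod = x}) ⟨_, l, rfl, h1, h2⟩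

theorem wordNorm_one (T : Set H) : wordNorm T (1 : H) = 0 := by
  have := wordNorm_le (T := T) [] (by simp)
  simpa using this

theorem wordNorm_mul_le {T : Set H} (hT : Subgroup.closure T = ⊤) (x y : H) :
    wordNorm T (x * y) ≤ wordNorm T x + wordNorm T y := by
  obtain ⟨l, h1, h2, rfl⟩ := wordNorm_spec hT x
  obtain ⟨m, k1, k2, rfl⟩ := wordNorm_spec hT y
  rw [← h1, ← k1, ← List.prod_append, ← List.length_append]
  refine wordNorm_le _ ?_
  intro g hg
  rcases List.mem_append.1 hg with h | h
  · exact h2 g h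
  · exact k2 g h

theorem wordNorm_inv_le {T : Set H} (hT : Subgroup.closure T = ⊤) (x : H) :
    wordNorm T x⁻¹ ≤ wordNorm T x := by
  obtain ⟨l, h1, h2, h3⟩ := wordNorm_spec hT x
  have := wordNorm_le (T := T) (l.map fun g => g⁻¹).reverse (by
    intro g hg
    simp only [List.mem_reverse, List.mem_map] at hg
    obtain ⟨a, ha, rfl⟩ := hg
    rw [inv_inv]
    exact (h2 a ha).symm)
  rw [← List.prod_inv_reverse, h3] at this
  simpa [h1] using this

theorem wordNorm_inv {T : Set H} (hT : Subgroup.closure T = ⊤) (x : H) :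
    wordNorm T x⁻¹ = wordNorm T x := by
  refine le_antisymm (wordNorm_inv_le hT x) ?_
  simpa using wordNorm_inv_le hT x⁻¹

theorem wordNorm_finite {T : Set H} (hT : Subgroup.closure T = ⊤) (hfin : T.Finite) (r : ℕ) :
    {x : H | wordNorm T x ≤ r}.Finite := by
  have hU : (T ∪ T⁻¹).Finite := hfin.union hfin.inv
  have : Finite ↥(T ∪ T⁻¹) := hU
  have h := List.finite_length_le (↥(T ∪ T⁻¹)) r
  refine (h.image fun l => (l.map Subtype.val).prod).subset ?_
  intro x hx
  obtain ⟨l, h1, h2, h3⟩ := wordNorm_spec hT x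
  have hl : ∀ g ∈ l, g ∈ T ∪ T⁻¹ := h2
  refine ⟨l.attach.map fun g => ⟨g.1, hl g.1 g.2⟩, ?_, ?_⟩
  · simp only [Set.mem_ofPred_eq, List.length_map, List.length_attach]
    rw [h1]; exact hx
  · simp [List.map_map, Function.comp_def, h3]

theorem wordNorm_map_le {G : Type*} [Group G] {S : Set G} (hS : Subgroup.closure S = ⊤)
    (f : G →* H) {T : Set H} (h : f '' S ⊆ T) (x : G) :
    wordNorm T (f x) ≤ wordNorm S x := by
  obtain ⟨l, h1, h2, rfl⟩ := wordNorm_spec hS x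
  have := wordNorm_le (T := T) (l.map f) (by
    intro g hg
    obtain ⟨a, ha, rfl⟩ := List.mem_map.1 hg
    rcases h2 a ha with h' | h'
    · exact Or.inl (h ⟨a, h', rfl⟩)
    · exact Or.inr (h ⟨a⁻¹, h', by simp⟩))
  rw [← map_list_prod, List.length_map, h1] at this
  exact this

end WordNorm

theorem ColAt.range {G H : Type u} [Group G] [Group H] {S : Set G} {T : Set H}
    (hS : Subgroup.closure S = ⊤) (hT : Subgroup.closure T = ⊤) (hfin : T.Finite)
    (f : G →* H) (hf : Function.Injective f) (hST : f '' S ⊆ T) {n : ℕ}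
    (h : ∀ d, ColAt (fun x y => wordNorm S (x⁻¹ * y)) (Set.univ : Set G) n d) (d : ℕ) :
    ColAt (fun x y => wordNorm T (x⁻¹ * y)) (f.range : Set H) n d := by
  have hfb : {x : G | wordNorm T (f x) ≤ d}.Finite :=
    (wordNorm_finite hT hfin d).preimage hf.injOn
  obtain ⟨D, hD⟩ := (hfb.image (wordNorm S)).bddAbove
  have hD' : ∀ x, wordNorm T (f x) ≤ d → wordNorm S x ≤ D := fun x hx => hD ⟨x, hx, rfl⟩
  obtain ⟨R, L, c, l, hl⟩ := h (D + 1)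
  have hg : ∀ x, Function.invFun f (f x) = x := Function.leftInverse_invFun hf
  refine ⟨R, L, fun x => c (Function.invFun f x), fun x => l (Function.invFun f x), ?_⟩
  rintro _ ⟨x, rfl⟩ _ ⟨y, rfl⟩ hc
  simp only [hg] at hc ⊢
  obtain ⟨h1, h2⟩ := hl x trivial y trivial hc
  rw [← map_inv, ← map_mul]
  constructor
  · intro e
    exact (wordNorm_map_le hS f hST _).trans (h1 e)
  · intro e
    by_contra hlt
    push Not at hlt
    have := h2 e
    dsimp only at this
    have := hD' _ hlt.le
    omega

section HNN

open HNNExtension HNNExtension.NormalWord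

variable {G : Type u} [Group G] {A B : Subgroup G} {φ : A ≃* B}

/-- Elements represented by a Mathlib reduced word of length `l`. -/
def QSet (φ : A ≃* B) (l : ℕ) : Set (HNNExtension G A B φ) :=
  {x | ∃ w : ReducedWord G A B, w.toList.length = l ∧ w.prod φ = x}

theorem QSet_mul_of {l : ℕ} {x : HNNExtension G A B φ} (hx : x ∈ QSet φ l) (g : G) :
    x * of g ∈ QSet φ l := by
  obtain ⟨⟨h, L, hL⟩, rfl, rfl⟩ := hx
  rcases List.eq_nil_or_concat L with rfl | ⟨M, ⟨u, a⟩, rfl⟩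
  · exact ⟨⟨h * g, [], List.isChain_nil⟩, rfl, by simp [ReducedWord.prod]⟩
  · refine ⟨⟨h, M ++ [(u, a * g)], ?_⟩, by simp, by simp [ReducedWord.prod, mul_assoc]⟩
    rw [List.concat_eq_append, List.isChain_append] at hL
    rw [List.isChain_append]
    refine ⟨hL.1, List.isChain_singleton _, ?_⟩
    intro p hp q hq
    have := hL.2.2 p hp (u, a) (by simp)
    simp only [List.head?_cons, Option.mem_def, Option.some.injEq] at hq
    subst hq
    exact this

theorem QSet_len {l m : ℕ} {x : HNNExtension G A B φ} (h1 : x ∈ QSet φ l)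
    (h2 : x ∈ QSet φ m) : l = m := by
  obtain ⟨w, rfl, hw⟩ := h1
  obtain ⟨v, rfl, hv⟩ := h2
  have := (ReducedWord.map_fst_eq_and_of_prod_eq φ (hw.trans hv.symm)).1
  simpa using congrArg List.length this

theorem conj_mem (u : ℤˣ) (a : G) (ha : a ∈ toSubgroup A B u) :
    ∃ b : G, (t ^ (u : ℤ) * of a * t ^ ((-u : ℤˣ) : ℤ) : HNNExtension G A B φ) = of b := by
  rcases Int.units_eq_one_or u with rfl | rfl
  · exact ⟨φ ⟨a, ha⟩, by rw [equiv_eq_conj]; simp⟩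
  · exact ⟨φ.symm ⟨a, ha⟩, by rw [equiv_symm_eq_conj]; simp⟩

theorem QSet_step {l : ℕ} (h : HNNExtension G A B φ)
    (hh : h ∉ (of : G →* HNNExtension G A B φ).range) :
    ∃ k, ∀ w ∈ QSet φ (l + 1), w * h ∈ QSet φ (l + 1) → w * k ∈ QSet φ l := by
  obtain ⟨d⟩ := TransversalPair.nonempty G A B
  obtain ⟨v, hv⟩ := (NormalWord.equiv φ d).symm.surjective h
  have hv' : v.toReducedWord.prod φ = h := hv
  obtain ⟨⟨h0, M, hM⟩, hmem⟩ := v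
  dsimp only at hv'
  cases M with
  | nil => exact absurd ⟨h0, by simpa [ReducedWord.prod] using hv'⟩ hh
  | cons p M =>
  obtain ⟨δ, h1⟩ := p
  refine ⟨of h0 * t ^ (δ : ℤ), ?_⟩
  rintro _ ⟨⟨g0, L, hL⟩, hlen, rfl⟩ hwh
  dsimp only at hlen
  rcases List.eq_nil_or_concat L with rfl | ⟨L, ⟨u, a⟩, rfl⟩
  · simp at hlen
  rw [List.concat_eq_append] at hL
  have hL' := List.isChain_append.1 hL
  by_cases hc : a * h0 ∈ toSubgroup A B u → u = δ
  · exfalso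
    have hch : (L ++ (u, a * h0) :: (δ, h1) :: M).IsChain
        (fun a b : ℤˣ × G => a.2 ∈ toSubgroup A B a.1 → a.1 = b.1) := by
      rw [List.isChain_append]
      refine ⟨hL'.1, List.isChain_cons_cons.2 ⟨hc, hM⟩, ?_⟩
      intro p hp q hq
      have := hL'.2.2 p hp (u, a) (by simp)
      simp only [List.head?_cons, Option.mem_def, Option.some.injEq] at hq
      subst hq
      exact this
    have h2 : ReducedWord.prod φ ⟨g0, L.concat (u, a), by simpa using hL⟩ * h ∈
        QSet φ (l + 1 + (M.length + 1)) := by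
      refine ⟨⟨g0, L ++ (u, a * h0) :: (δ, h1) :: M, hch⟩, ?_, ?_⟩
      · simp at hlen ⊢
        omega
      · rw [← hv']
        simp [ReducedWord.prod, mul_assoc]
    have := QSet_len hwh h2
    omega
  · push Not at hc
    obtain ⟨ha, hne⟩ := hc
    have hδ : δ = -u := Int.units_ne_iff_eq_neg.1 (Ne.symm hne)
    subst hδ
    obtain ⟨b, hb⟩ := conj_mem (φ := φ) u _ ha
    have hpre : ReducedWord.prod φ ⟨g0, L, hL'.1⟩ ∈ QSet φ l :=
      ⟨_, by simpa using hlen, rfl⟩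
    have := QSet_mul_of hpre b
    rw [← hb] at this
    convert this using 1
    simp [ReducedWord.prod, mul_assoc]

theorem HNNLengthSet_subset (l : ℕ) : HNNLengthSet A B φ l ⊆ QSet φ l := by
  rintro x ⟨g, ε, ⟨hε, hred⟩, rfl⟩
  have : ∀ i, ∃ u : ℤˣ, (u : ℤ) = ε i := by
    intro i
    rcases hε i with h | h
    · exact ⟨1, by simp [h]⟩
    · exact ⟨-1, by simp [h]⟩
  choose u hu using this
  refine ⟨⟨g 0, List.ofFn fun i => (u i, g i.succ), ?_⟩, by simp, ?_⟩
  · rw [List.isChain_iff_getElem]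
    intro j hj
    simp only [List.length_ofFn] at hj
    simp only [List.getElem_ofFn]
    intro hmem
    have h := hred j hj
    rw [← hu, ← hu] at h
    have e : (Fin.succ ⟨j, Nat.lt_of_succ_lt hj⟩ : Fin (l + 1)) = ⟨j + 1, by omega⟩ := rfl
    rw [e] at hmem
    rcases Int.units_eq_one_or (u ⟨j, Nat.lt_of_succ_lt hj⟩) with h1 | h1 <;>
    rcases Int.units_eq_one_or (u ⟨j + 1, hj⟩) with h2 | h2
    · rw [h1, h2]
    · rw [h1] at hmem
      exact absurd hmem (h.1 (by simp [h1, h2]))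
    · rw [h1] at hmem
      exact absurd hmem (h.2 (by simp [h1, h2]))
    · rw [h1, h2]
  · simp [ReducedWord.prod, List.map_ofFn, Function.comp_def, hu]

theorem closure_gen {S : Set G} (hS : Subgroup.closure S = ⊤) :
    Subgroup.closure ((of : G →* HNNExtension G A B φ) '' S ∪ {t, t⁻¹}) = ⊤ := by
  rw [eq_top_iff]
  intro x _
  induction x using HNNExtension.induction_on with
  | of g =>
    have : g ∈ Subgroup.closure S := by rw [hS]; trivial
    have h2 : of g ∈ (Subgroup.closure S).map (of : G →* HNNExtension G A B φ) :=
      ⟨g, this, rfl⟩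
    rw [MonoidHom.map_closure] at h2
    exact Subgroup.closure_mono Set.subset_union_left h2
  | t => exact Subgroup.subset_closure (by simp)
  | mul x y hx hy => exact mul_mem (hx trivial) (hy trivial)
  | inv x hx => exact inv_mem (hx trivial)

end HNN

/-- **Proposition 7.** Let `G'` be the HNN extension of a finitely generated group `G`
by `φ : A ≃* B`, with the word metric from `S' = S ∪ {y, y⁻¹}`.  If `asdim G ≤ n`,
`n > 0`, then `asdim P_l ≤ n` for every `l`, where `P_l` is the set of elements with
reduced presentation of length `l`, with the induced metric. -/
theorem asdim_HNNLengthSet_le {G : Type*} [Group G] (A B : Subgroup G) (φ : A ≃* B)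
    (S : Finset G) (hS : Subgroup.closure (S : Set G) = ⊤)
    (n : ℕ) (hn : 0 < n)
    (hG : AsdimOnLE (wordDist (S : Set G)) (Set.univ : Set G) n) (l : ℕ) :
    AsdimOnLE
      (wordDist ((HNNExtension.of : G →* HNNExtension G A B φ) '' (S : Set G) ∪
        {HNNExtension.t, (HNNExtension.t)⁻¹}))
      (HNNLengthSet A B φ l) n := by
  have hT := closure_gen (φ := φ) hS
  set T : Set (HNNExtension G A B φ) :=
    (HNNExtension.of : G →* HNNExtension G A B φ) '' (S : Set G) ∪
        {HNNExtension.t, (HNNExtension.t)⁻¹} with hTdef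
  have hfin : T.Finite := (S.finite_toSet.image _).union (by simp)
  have hK := ColAt.range hS hT hfin (HNNExtension.of : G →* HNNExtension G A B φ)
    (HNNExtension.of_injective φ) Set.subset_union_left (ColAt.ofAsdim hG)
  have hQ : ∀ l d, ColAt (fun x y => wordNorm T (x⁻¹ * y)) (QSet φ l) n d := by
    intro l
    induction l with
    | zero =>
      intro d
      refine (hK d).mono ?_
      rintro _ ⟨⟨g, L, hL⟩, hlen, rfl⟩
      obtain rfl : L = [] := List.length_eq_zero_iff.1 hlen
      exact ⟨g, by simp [HNNExtension.NormalWord.ReducedWord.prod]⟩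
    | succ l ih =>
      exact ColAt.step (wordNorm T) (wordNorm_one T) (wordNorm_inv hT) (wordNorm_mul_le hT)
        (wordNorm_finite hT hfin) _ hK ih QSet_step
  exact ColAt.toAsdim fun d => (hQ l d).mono (HNNLengthSet_subset l)
end
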